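/- Let λ ≥ 1 be an integer, let G be a finite simple graph with n vertices and minimum degree δ, and let C be a longest cycle in G. If δ ≥ (n+2)/(λ+1) + λ − 2, then either p̄ ≤ min{λ − 2, δ − λ − 1} or p̄ ≥ max{λ, δ − λ + 1}, where p̄ is the length of a longest path in the subgraph of G induced by the vertices not on C (with p̄ = −1 when C is a Hamilton cycle). -/

import Mathlib

open SimpleGraph

/-- A cycle `C` is a longest cycle in `G` if no cycle of `G` has greater length. -/
def IsLongestCycle {V : Type*} (G : SimpleGraph V) {v : V} (C : G.Walk v v) : Prop :=
  C.IsCycle ∧ ∀ (u : V) (D : G.Walk u u), D.IsCycle → D.length ≤ C.length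

open scoped Classical in
/-- The length of a longest path in `H`, with the convention that it is `-1`
when `H` has no vertices. -/
noncomputable def pbar {W : Type*} (H : SimpleGraph W) : ℤ :=
  if Nonempty W then
    ((sSup {n : ℕ | ∃ (u v : W) (p : H.Walk u v), p.IsPath ∧ p.length = n} : ℕ) : ℤ)
  else -1

/-- The length of a longest cycle in `H`, where a single vertex counts as a cycle of
length 1 and a single edge as a cycle of length 2, with the convention that it is `0`
when `H` has no vertices. -/
noncomputable def cbar {W : Type*} (H : SimpleGraph W) : ℕ :=
  sSup {n : ℕ | (n = 1 ∧ Nonempty W) ∨ (n = 2 ∧ ∃ u v : W, H.Adj u v) ∨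
    ∃ (v : W) (c : H.Walk v v), c.IsCycle ∧ c.length = n}

/-- `G` is `k`-connected: it has at least `k+1` vertices and remains connected
after the deletion of any set of fewer than `k` vertices. -/
def IsKConnected {V : Type*} [Fintype V] (G : SimpleGraph V) (k : ℕ) : Prop :=
  k + 1 ≤ Fintype.card V ∧
    ∀ S : Finset V, S.card < k → (G.induce ((↑S : Set V)ᶜ)).Connected

/-- Chords from a cyclically ordered set of `c` points to a linearly ordered set, such that chords
with different first endpoints are cyclically further apart than their second endpoints, are few. -/
theorem card_mul_le_of_cyclic_gap {c p : ℕ} (S : Fin c → Finset (Fin (p + 1)))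
    (hgap : ∀ a a' i i', a < a' → i ∈ S a → i' ∈ S a' → (i : ℕ) ≤ i' →
      (i' - i : ℤ) + 2 ≤ a' - a ∧ (i' - i : ℤ) + 2 ≤ c - (a' - a))
    (hgap' : ∀ a a' i i', a < a' → i ∈ S a → i' ∈ S a' → (i' : ℕ) ≤ i →
      (i - i' : ℤ) + 2 ≤ a' - a ∧ (i - i' : ℤ) + 2 ≤ c - (a' - a))
    (hself : ∀ a, ∀ i ∈ S a, ∀ i' ∈ S a, (i' - i : ℤ) + 2 ≤ c) :
    (p + 2) * ∑ a, (S a).card ≤ c * (p + 1) := by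
  classical
  let N : Fin c → Finset ℕ := fun a => (S a).image (fun i : Fin (p + 1) => (i : ℕ))
  let T : Fin c → Finset ℕ := fun a => N a ∪ (N a).image (· + 1)
  have hNcard : ∀ a, (N a).card = (S a).card := fun a =>
    Finset.card_image_of_injective _ Fin.val_injective
  have hmem : ∀ a, ∀ t ∈ T a, ∃ i ∈ S a, t = (i : ℕ) ∨ t = (i : ℕ) + 1 := by
    intro a t ht
    simp only [T, N, Finset.mem_union, Finset.mem_image] at ht
    grind
  have hT : ∀ a, (p + 2) * (S a).card ≤ (p + 1) * (T a).card := by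
    intro a
    rcases (S a).eq_empty_or_nonempty with h | h
    · simp [h]
    · have h1 : (S a).card ≤ p + 1 := by simpa using (S a).card_le_univ
      have hne : (N a).Nonempty := h.image _
      have h2 : (S a).card + 1 ≤ (T a).card := by
        rw [← hNcard]
        have hnot : (N a).max' hne + 1 ∉ N a := fun hx => by
          have := (N a).le_max' _ hx
          omega
        rw [← Finset.card_insert_of_notMem hnot]
        refine Finset.card_le_card (Finset.insert_subset ?_ Finset.subset_union_left)
        exact Finset.mem_union_right _ (Finset.mem_image_of_mem _ ((N a).max'_mem hne))
      nlinarith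
  have key : ∀ (a a' : Fin c) (t t' : ℕ), t ∈ T a → t' ∈ T a' → a < a' →
      (a + t) % c ≠ (a' + t') % c := by
    intro a a' t t' ht ht' hlt heq
    obtain ⟨i, hi, hti⟩ := hmem a t ht
    obtain ⟨i', hi', hti'⟩ := hmem a' t' ht'
    have hd : (c : ℤ) ∣ ((a' + t' : ℕ) : ℤ) - ((a + t : ℕ) : ℤ) := Nat.modEq_iff_dvd.mp heq
    have hlt' : (a : ℕ) < a' := hlt
    have h1 := hgap a a' i i' hlt hi hi'
    have h2 := hgap' a a' i i' hlt hi hi'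
    have hb : 0 < ((a' + t' : ℕ) : ℤ) - ((a + t : ℕ) : ℤ) ∧
        ((a' + t' : ℕ) : ℤ) - ((a + t : ℕ) : ℤ) < c := by
      push_cast
      rcases le_total (i : ℕ) i' with h | h
      · have := h1 h
        omega
      · have := h2 h
        omega
    have := Int.le_of_dvd hb.1 hd
    omega
  have key' : ∀ (a : Fin c) (t t' : ℕ), t ∈ T a → t' ∈ T a → t < t' →
      (a + t) % c ≠ (a + t') % c := by
    intro a t t' ht ht' hlt heq
    obtain ⟨i, hi, hti⟩ := hmem a t ht
    obtain ⟨i', hi', hti'⟩ := hmem a t' ht'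
    have hd : (c : ℤ) ∣ ((a + t' : ℕ) : ℤ) - ((a + t : ℕ) : ℤ) := Nat.modEq_iff_dvd.mp heq
    have h1 := hself a i hi i' hi'
    have := Int.le_of_dvd (by push_cast; omega) hd
    push_cast at this
    omega
  have hsum : ∑ a, (T a).card ≤ c := by
    rw [← Finset.card_sigma]
    refine le_of_le_of_eq ?_ (Finset.card_range c)
    refine Finset.card_le_card_of_injOn (fun x => ((x.1 : ℕ) + x.2) % c) ?_ ?_
    · rintro ⟨a, t⟩ -
      simpa using Nat.mod_lt _ (a.pos)
    · rintro ⟨a, t⟩ ht ⟨a', t'⟩ ht' heq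
      simp only [Finset.coe_sigma, Finset.coe_univ, Set.mem_sigma_iff, Set.mem_univ,
        Finset.mem_coe, true_and] at ht ht'
      rcases lt_trichotomy a a' with h | h | h
      · exact (key a a' t t' ht ht' h heq).elim
      · subst h
        rcases lt_trichotomy t t' with h | h | h
        · exact (key' a t t' ht ht' h heq).elim
        · rw [h]
        · exact (key' a t' t ht' ht h heq.symm).elim
      · exact (key a' a t' t ht' ht h heq.symm).elim
  calc (p + 2) * ∑ a, (S a).card = ∑ a, (p + 2) * (S a).card := Finset.mul_sum ..
    _ ≤ ∑ a, (p + 1) * (T a).card := Finset.sum_le_sum fun a _ => hT a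
    _ = (p + 1) * ∑ a, (T a).card := (Finset.mul_sum ..).symm
    _ ≤ c * (p + 1) := by rw [mul_comm]; exact Nat.mul_le_mul_right _ hsum

/-- A list enumerates the vertices of a path of `G` in order. -/
def IsPathList {V : Type*} (G : SimpleGraph V) (l : List V) : Prop :=
  l.IsChain G.Adj ∧ l.Nodup

/-- A list enumerates the vertices of a cycle of `G` in cyclic order. -/
def IsCycleList {V : Type*} (G : SimpleGraph V) (l : List V) : Prop :=
  IsPathList G l ∧ 3 ≤ l.length ∧ ∀ x ∈ l.head?, ∀ y ∈ l.getLast?, G.Adj y x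

theorem IsPathList.reverse {V : Type*} {G : SimpleGraph V} {l : List V} (h : IsPathList G l) :
    IsPathList G l.reverse := by
  refine ⟨List.isChain_reverse.mpr ?_, List.nodup_reverse.mpr h.2⟩
  simpa only [G.adj_comm] using h.1

theorem IsPathList.exists_walk {V : Type*} {G : SimpleGraph V} {l : List V} (h : IsPathList G l)
    (hne : l ≠ []) : ∃ (u v : V) (p : G.Walk u v), p.IsPath ∧ p.length + 1 = l.length := by
  refine ⟨_, _, Walk.ofSupport l hne h.1, ?_, ?_⟩
  · rw [Walk.isPath_def, Walk.support_ofSupport]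
    exact h.2
  · rw [Walk.length_ofSupport]
    have := List.length_pos_iff.mpr hne
    omega

theorem IsCycleList.exists_cycle {V : Type*} {G : SimpleGraph V} {l : List V}
    (h : IsCycleList G l) : ∃ (u : V) (c : G.Walk u u), c.IsCycle ∧ c.length = l.length := by
  obtain ⟨⟨hc, hn⟩, h3, hadj⟩ := h
  have hne : l ≠ [] := by rintro rfl; simp at h3
  have ha : G.Adj (l.getLast hne) (l.head hne) :=
    hadj _ (List.head?_eq_some_head hne) _ (List.getLast?_eq_some_getLast hne)
  refine ⟨_, Walk.cons ha (Walk.ofSupport l hne hc), ?_, ?_⟩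
  · rw [Walk.isCycle_iff_isPath_tail_and_le_length]
    refine ⟨?_, ?_⟩
    · rw [Walk.isPath_def]
      simpa using hn
    · simp; omega
  · simp; omega

theorem SimpleGraph.Walk.IsCycle.isCycleList {V : Type*} {G : SimpleGraph V} {v : V}
    {c : G.Walk v v} (hc : c.IsCycle) :
    IsCycleList G c.support.tail ∧ c.support.tail.length = c.length := by
  have h3 := hc.three_le_length
  cases c with
  | nil => simp at h3
  | cons h p =>
    refine ⟨⟨⟨?_, ?_⟩, ?_, ?_⟩, ?_⟩
    · simpa using p.isChain_adj_support
    · simpa using ((Walk.cons_isCycle_iff _ _).mp hc).1.support_nodup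
    · simpa using h3
    · intro x hx y hy
      simp only [Walk.support_cons, List.tail_cons] at hx hy
      rw [List.head?_eq_some_head p.support_ne_nil, Walk.head_support] at hx
      rw [List.getLast?_eq_some_getLast p.support_ne_nil, Walk.getLast_support] at hy
      simp only [Option.mem_def, Option.some.injEq] at hx hy
      subst hx hy
      exact h
    · simp

/-- Two vertices of a longest cycle joined through a path avoiding the cycle are far apart. -/
theorem IsCycleList.length_le_of_detour {V : Type*} {G : SimpleGraph V} {A B D Q : List V} {u w : V}
    (hL : IsCycleList G (A ++ u :: (B ++ w :: D)))
    (hmax : ∀ l, IsCycleList G l → l.length ≤ (A ++ u :: (B ++ w :: D)).length)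
    (hQ : IsPathList G Q) (hne : Q ≠ [])
    (hdisj : (A ++ u :: (B ++ w :: D)).Disjoint Q)
    (h1 : ∀ x ∈ Q.head?, G.Adj u x) (h2 : ∀ x ∈ Q.getLast?, G.Adj x w) :
    Q.length ≤ B.length ∧ Q.length ≤ A.length + D.length := by
  obtain ⟨⟨hc, hn⟩, h3, hadj⟩ := hL
  have hQpos := List.length_pos_iff.mpr hne
  constructor
  · have := hmax (A ++ u :: (Q ++ w :: D)) ?_
    · simp only [List.length_append, List.length_cons] at this; omega
    refine ⟨⟨?_, ?_⟩, ?_, ?_⟩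
    · simp only [List.isChain_append, List.isChain_cons] at hc ⊢
      refine ⟨hc.1, ⟨?_, hQ.1, hc.2.1.2.2.1, ?_⟩, hc.2.2⟩
      · intro y hy
        cases Q with
        | nil => exact absurd rfl hne
        | cons q Q => exact h1 y (by simpa using hy)
      · simpa using h2
    · have := hQ.2
      clear hadj hmax h1 h2 hc
      simp only [List.nodup_append', List.nodup_cons, List.mem_append, List.mem_cons,
        List.disjoint_append_left, List.disjoint_append_right, List.disjoint_cons_left,
        List.disjoint_cons_right, not_or] at hn hdisj ⊢
      have := hdisj.1.symm
      tauto
    · simp only [List.length_append, List.length_cons]; omega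
    · intro x hx y hy
      refine hadj x ?_ y ?_
      · cases A <;> simpa using hx
      · simp [List.getLast?_append, List.getLast?_cons] at hy ⊢; exact hy
  · have := hmax (u :: (B ++ w :: Q.reverse)) ?_
    · simp only [List.length_append, List.length_cons, List.length_reverse] at this; omega
    have hr := hQ.reverse
    refine ⟨⟨?_, ?_⟩, ?_, ?_⟩
    · simp only [List.isChain_append, List.isChain_cons] at hc ⊢
      refine ⟨?_, hc.2.1.2.1, ⟨?_, hr.1⟩, ?_⟩
      · cases B <;> simpa using hc.2.1.1
      · intro y hy
        exact (h2 y (by simpa using hy)).symm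
      · simpa using hc.2.1.2.2.2
    · have := hr.2
      clear hadj hmax h1 h2 hc
      simp only [List.nodup_append', List.nodup_cons, List.mem_append, List.mem_cons,
        List.disjoint_append_left, List.disjoint_append_right, List.disjoint_cons_left,
        List.disjoint_cons_right, not_or, List.mem_reverse, List.disjoint_reverse_right]
        at hn hdisj ⊢
      tauto
    · simp only [List.length_append, List.length_cons, List.length_reverse]; omega
    · intro x hx y hy
      cases Q with
      | nil => exact absurd rfl hne
      | cons q Q =>
        have hy' : q = y := by
          rw [show u :: (B ++ w :: (q :: Q).reverse) = (u :: (B ++ w :: Q.reverse)) ++ [q] by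
            simp] at hy
          simpa only [List.getLast?_concat, Option.mem_def, Option.some.injEq] using hy
        simp at hx
        subst hx hy'
        exact (h1 _ (by simp)).symm

theorem List.eq_take_append_cons_append_cons_drop {α : Type*} (L : List α) {a a' : ℕ} (ha : a < a')
    (ha' : a' < L.length) :
    L = L.take a ++ L[a] :: ((L.drop (a + 1)).take (a' - a - 1) ++
      L[a'] :: L.drop (a' + 1)) := by
  have e : (L.drop (a + 1)).drop (a' - a - 1) = L[a'] :: L.drop (a' + 1) := by
    rw [List.drop_drop, show a + 1 + (a' - a - 1) = a' by omega, List.getElem_cons_drop]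
  rw [← e, List.take_append_drop, List.getElem_cons_drop, List.take_append_drop]

theorem IsCycleList.gap {V : Type*} {G : SimpleGraph V} {L Q : List V} (hL : IsCycleList G L)
    (hmax : ∀ l, IsCycleList G l → l.length ≤ L.length) (hQ : IsPathList G Q) (hne : Q ≠ [])
    (hdisj : L.Disjoint Q) {a a' : ℕ} (ha : a < a') (ha' : a' < L.length)
    (h1 : ∀ x ∈ Q.head?, G.Adj L[a] x) (h2 : ∀ x ∈ Q.getLast?, G.Adj x L[a']) :
    a + Q.length + 1 ≤ a' ∧ a' + Q.length + 1 ≤ L.length + a := by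
  have hdec := List.eq_take_append_cons_append_cons_drop L ha ha'
  have hlen : ((L.drop (a + 1)).take (a' - a - 1)).length = a' - a - 1 ∧
      (L.take a).length = a ∧ (L.drop (a' + 1)).length = L.length - (a' + 1) := by
    simp; omega
  have key := IsCycleList.length_le_of_detour (hdec ▸ hL) (by rw [← hdec]; exact hmax) hQ hne
    (by rw [← hdec]; exact hdisj) h1 h2
  omega

theorem IsCycleList.length_add_one_le {V : Type*} {G : SimpleGraph V} {L Q : List V} {u : V}
    (hmax : ∀ l, IsCycleList G l → l.length ≤ L.length) (hQ : IsPathList G Q) (hu : u ∉ Q)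
    (h2 : 2 ≤ Q.length) (hhead : ∀ x ∈ Q.head?, G.Adj u x) (hlast : ∀ x ∈ Q.getLast?, G.Adj x u) :
    Q.length + 1 ≤ L.length := by
  refine le_of_eq_of_le (by simp) (hmax (u :: Q) ⟨⟨?_, ?_⟩, ?_, ?_⟩)
  · exact List.isChain_cons.mpr ⟨hhead, hQ.1⟩
  · exact List.nodup_cons.mpr ⟨hu, hQ.2⟩
  · simpa using h2
  · intro x hx y hy
    cases Q with
    | nil => simp at h2
    | cons q Q =>
      simp at hx
      subst hx
      exact hlast y (by simpa [List.getLast?_cons_cons] using hy)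

/-- A segment of a longest path cannot be replaced by a longer one. -/
theorem IsPathList.length_add_one_le_of_detour {W : Type*} {H : SimpleGraph W} {P M : List W}
    (hP : IsPathList H P) (hmax : ∀ l, IsPathList H l → l.length ≤ P.length) {k k' : ℕ}
    (hk : k < k') (hk' : k' < P.length) (hM : M.Nodup) (hd : M.Disjoint P)
    (hc : List.IsChain H.Adj (P[k] :: (M ++ [P[k']]))) : k + M.length + 1 ≤ k' := by
  have hdec := List.eq_take_append_cons_append_cons_drop P hk hk'
  have hlen : ((P.drop (k + 1)).take (k' - k - 1)).length = k' - k - 1 := by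
    simp; omega
  generalize (P.drop (k + 1)).take (k' - k - 1) = B at hdec hlen
  generalize P.take k = A at hdec
  generalize P.drop (k' + 1) = D at hdec
  generalize P[k] = u at hdec hc
  generalize P[k'] = w at hdec hc
  clear hk'
  subst hdec
  have := hmax (A ++ u :: (M ++ w :: D)) ⟨?_, ?_⟩
  · simp only [List.length_append, List.length_cons] at this; omega
  · have h1 := hP.1
    simp only [List.isChain_append, List.isChain_cons] at h1 hc ⊢
    refine ⟨h1.1, ⟨?_, hc.2.1, h1.2.1.2.2.1, ?_⟩, h1.2.2⟩
    · cases M <;> simpa using hc.1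
    · simpa using hc.2.2.2
  · have hn := hP.2
    clear hmax hP hc
    simp only [List.nodup_append', List.nodup_cons, List.mem_append, List.mem_cons,
      List.disjoint_append_right, List.disjoint_cons_right, not_or] at hn hd ⊢
    have := hd.1.symm
    tauto

/-- An end of a longest path cannot be replaced by a longer one. -/
theorem IsPathList.length_le_of_branch {W : Type*} {H : SimpleGraph W} {P M : List W}
    (hP : IsPathList H P) (hmax : ∀ l, IsPathList H l → l.length ≤ P.length) {k : ℕ}
    (hk : k < P.length) (hM : M.Nodup) (hd : M.Disjoint P)
    (hc : List.IsChain H.Adj (P[k] :: M)) : M.length ≤ k ∧ k + M.length + 1 ≤ P.length := by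
  have hdec : P = P.take k ++ P[k] :: P.drop (k + 1) := by
    rw [List.getElem_cons_drop, List.take_append_drop]
  have hlen : (P.take k).length = k := by simp; omega
  generalize P.take k = A at hdec hlen
  generalize P.drop (k + 1) = D at hdec
  generalize P[k] = u at hdec hc
  clear hk
  subst hdec
  have h1 := hP.1
  have hn := hP.2
  have hr : IsPathList H M.reverse := IsPathList.reverse ⟨(List.isChain_cons.mp hc).2, hM⟩
  constructor
  · have := hmax (M.reverse ++ u :: D) ⟨?_, ?_⟩
    · simp only [List.length_append, List.length_cons, List.length_reverse] at this; omega
    · simp only [List.isChain_append, List.isChain_cons] at h1 hc ⊢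
      refine ⟨hr.1, h1.2.1, ?_⟩
      intro x hx y hy
      have := hc.1 x (by simpa using hx)
      simp at hy
      exact hy ▸ this.symm
    · have := hr.2
      clear hmax hP hc
      simp only [List.nodup_append', List.nodup_cons, List.disjoint_append_right,
        List.disjoint_cons_right, List.disjoint_reverse_left, List.mem_reverse] at hn hd ⊢
      tauto
  · have := hmax (A ++ u :: M) ⟨?_, ?_⟩
    · simp only [List.length_append, List.length_cons] at this ⊢; omega
    · simp only [List.isChain_append, List.isChain_cons] at h1 hc ⊢
      exact ⟨h1.1, hc, h1.2.2⟩
    · clear hmax hP hc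
      simp only [List.nodup_append', List.nodup_cons, List.disjoint_append_right,
        List.disjoint_cons_right] at hn hd ⊢
      have := hd.1.symm
      tauto

theorem Finset.two_mul_card_le_of_separated {α : Type*} (X : Finset α) (k s : α → ℕ) (p : ℕ)
    (hend : ∀ w ∈ X, s w + 1 ≤ k w ∧ k w + s w + 1 ≤ p)
    (hinj : ∀ w ∈ X, ∀ w' ∈ X, k w = k w' → s w = s w' → w = w')
    (hsep : ∀ w ∈ X, ∀ w' ∈ X, k w < k w' → k w + s w + s w' + 2 ≤ k w') :
    2 * X.card ≤ p := by
  have hdisj : Disjoint (X.image fun w => k w - s w) (X.image fun w => k w + s w + 1) := by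
    rw [Finset.disjoint_left]
    intro x hx hx'
    obtain ⟨w, hw, rfl⟩ := Finset.mem_image.mp hx
    obtain ⟨w', hw', he⟩ := Finset.mem_image.mp hx'
    have := hsep w hw w' hw'
    have := hsep w' hw' w hw
    omega
  have h1 : (X.image fun w => k w - s w).card = X.card := by
    refine Finset.card_image_of_injOn fun w hw w' hw' he => ?_
    simp only [Finset.mem_coe] at hw hw' he
    have := hsep w hw w' hw'
    have := hsep w' hw' w hw
    have := hend w hw
    have := hend w' hw'
    exact hinj w hw w' hw' (by omega) (by omega)
  have h2 : (X.image fun w => k w + s w + 1).card = X.card := by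
    refine Finset.card_image_of_injOn fun w hw w' hw' he => ?_
    simp only [Finset.mem_coe] at hw hw' he
    have := hsep w hw w' hw'
    have := hsep w' hw' w hw
    exact hinj w hw w' hw' (by omega) (by omega)
  have h3 : ((X.image fun w => k w - s w) ∪ (X.image fun w => k w + s w + 1)).card ≤
      (Finset.Icc 1 p).card := by
    refine Finset.card_le_card fun x hx => ?_
    rw [Finset.mem_Icc]
    rcases Finset.mem_union.mp hx with h | h <;> obtain ⟨w, hw, rfl⟩ := Finset.mem_image.mp h <;>
      have := hend w hw <;> omega
  rw [Finset.card_union_of_disjoint hdisj, h1, h2, Nat.card_Icc] at h3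
  omega

/-- A system of pairwise disjoint paths leaving the path `P` at each of its vertices;
`F i` lists the vertices of the `i`-th one without its start on `P`. -/
structure IsExtension {W : Type*} (H : SimpleGraph W) (P : List W)
    (F : Fin P.length → List W) : Prop where
  path : ∀ i : Fin P.length, IsPathList H (P[(i : ℕ)] :: F i)
  off : ∀ i, (F i).Disjoint P
  disjoint : ∀ i j, i ≠ j → (F i).Disjoint (F j)

/-- The number of vertices added by an extension plus the number of its nontrivial paths. -/
def extensionWeight {W : Type*} {P : List W} (F : Fin P.length → List W) : ℕ :=
  ∑ i, ((F i).length + if F i = [] then 0 else 1)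

theorem extensionWeight_update {W : Type*} [DecidableEq W] {P : List W} (F : Fin P.length → List W)
    (i : Fin P.length) (l : List W) :
    extensionWeight (Function.update F i l) + ((F i).length + if F i = [] then 0 else 1) =
      extensionWeight F + (l.length + if l = [] then 0 else 1) := by
  unfold extensionWeight
  rw [← Finset.add_sum_erase _ _ (Finset.mem_univ i),
    ← Finset.add_sum_erase Finset.univ (fun j => (F j).length + _) (Finset.mem_univ i)]
  have : ∀ j ∈ Finset.univ.erase i, ((Function.update F i l j).length +
      if Function.update F i l j = [] then 0 else 1) =
      (F j).length + if F j = [] then 0 else 1 := by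
    intro j hj
    rw [Function.update_of_ne (Finset.ne_of_mem_erase hj)]
  rw [Finset.sum_congr rfl this]
  simp only [Function.update_self]
  omega

theorem IsExtension.update {W : Type*} {H : SimpleGraph W} {P : List W}
    {F : Fin P.length → List W} (hF : IsExtension H P F) {i : Fin P.length} {l : List W}
    (hl : IsPathList H (P[(i : ℕ)] :: l)) (hP : l.Disjoint P)
    (hd : ∀ j, j ≠ i → l.Disjoint (F j)) : IsExtension H P (Function.update F i l) := by
  refine ⟨fun j => ?_, fun j => ?_, fun j j' hj => ?_⟩
  · by_cases h : j = i
    · subst h; simpa using hl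
    · simpa [h] using hF.path j
  · by_cases h : j = i
    · subst h; simpa using hP
    · simpa [h] using hF.off j
  · by_cases h : j = i
    · subst h; simpa [hj.symm] using hd j' hj.symm
    · by_cases h' : j' = i
      · subst h'; simpa [h] using (hd j h).symm
      · simpa [h, h'] using hF.disjoint j j' hj

theorem exists_isExtension_maximal {W : Type*} [Fintype W] (H : SimpleGraph W) (P : List W) :
    ∃ F : Fin P.length → List W, IsExtension H P F ∧
      ∀ F', IsExtension H P F' → extensionWeight F' ≤ extensionWeight F := by
  let S : Set ℕ := {m | ∃ F : Fin P.length → List W, IsExtension H P F ∧ extensionWeight F = m}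
  have hne : S.Nonempty := ⟨_, fun _ => [], ⟨fun i => ⟨by simp, by simp⟩, by simp, by simp⟩, rfl⟩
  have hbdd : BddAbove S := by
    refine ⟨∑ _i : Fin P.length, (Fintype.card W + 1), ?_⟩
    rintro m ⟨F, hF, rfl⟩
    refine Finset.sum_le_sum fun i _ => ?_
    have := (List.nodup_cons.mp (hF.path i).2).2.length_le_card
    split_ifs <;> omega
  obtain ⟨F, hF, hw⟩ := Nat.sSup_mem hne hbdd
  exact ⟨F, hF, fun F' hF' => hw ▸ le_csSup hbdd ⟨F', hF', rfl⟩⟩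

/-- The end of the `i`-th path of an extension. -/
def extensionTip {W : Type*} {P : List W} (F : Fin P.length → List W) (i : Fin P.length) : W :=
  (P[(i : ℕ)] :: F i).getLast (List.cons_ne_nil _ _)

section Extension

variable {W : Type*} {H : SimpleGraph W} {P : List W} {F : Fin P.length → List W}

theorem extensionTip_of_eq_nil {i : Fin P.length} (h : F i = []) :
    extensionTip F i = P[(i : ℕ)] := by
  simp [extensionTip, h]

theorem extensionTip_mem_of_ne_nil {i : Fin P.length} (h : F i ≠ []) : extensionTip F i ∈ F i := by
  rw [extensionTip, List.getLast_cons h]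
  exact List.getLast_mem h

theorem getLast?_eq_extensionTip (i : Fin P.length) :
    (P[(i : ℕ)] :: F i).getLast? = some (extensionTip F i) :=
  List.getLast?_eq_some_getLast _

/-- Tips of a maximal extension have no neighbours outside the extension. -/
theorem IsExtension.mem_of_adj_tip [DecidableEq W] (hF : IsExtension H P F)
    (hmax : ∀ F', IsExtension H P F' → extensionWeight F' ≤ extensionWeight F)
    {i : Fin P.length} {w : W} (hw : H.Adj (extensionTip F i) w) : w ∈ P ∨ ∃ j, w ∈ F j := by
  by_contra! hcon
  have hext : IsExtension H P (Function.update F i (F i ++ [w])) := by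
    refine hF.update ⟨?_, ?_⟩ ?_ ?_
    · rw [← List.cons_append, List.isChain_append]
      refine ⟨(hF.path i).1, by simp, ?_⟩
      rw [getLast?_eq_extensionTip]
      simpa using hw
    · rw [← List.cons_append, List.nodup_append']
      refine ⟨(hF.path i).2, by simp, ?_⟩
      simp only [List.disjoint_singleton, List.mem_cons, not_or]
      refine ⟨?_, hcon.2 i⟩
      rintro rfl
      exact hcon.1 (List.getElem_mem _)
    · rw [List.disjoint_append_left]
      exact ⟨hF.off i, by simpa using hcon.1⟩
    · intro j hj
      rw [List.disjoint_append_left]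
      exact ⟨hF.disjoint _ _ hj.symm, by simpa using hcon.2 j⟩
  have h1 := hmax _ hext
  have h2 := extensionWeight_update F i (F i ++ [w])
  simp only [List.length_append, List.length_singleton] at h2
  rw [if_neg (show F i ++ [w] ≠ [] by simp)] at h2
  split_ifs at h2 <;> omega

/-- In a maximal extension, a trivial path can only be adjacent to the first vertices of the
nontrivial ones. -/
theorem IsExtension.head?_eq_of_adj [DecidableEq W] (hF : IsExtension H P F)
    (hmax : ∀ F', IsExtension H P F' → extensionWeight F' ≤ extensionWeight F)
    {i j : Fin P.length} {w : W} (hi : F i = []) (hj : w ∈ F j) (hw : H.Adj P[(i : ℕ)] w) :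
    (F j).head? = some w := by
  obtain ⟨A, B, hAB⟩ := List.append_of_mem hj
  rcases eq_or_ne A [] with rfl | hA
  · simp [hAB]
  exfalso
  have hij : i ≠ j := by
    rintro rfl
    simp [hi] at hj
  have hpj := hF.path j
  have hpi := hF.path i
  have hoff := hF.off j
  have hjd := fun k (hk : k ≠ j) => hF.disjoint j k hk.symm
  rw [hAB] at hpj hoff hjd
  rw [hi] at hpi
  have h1 : IsExtension H P (Function.update F j A) := by
    refine hF.update ⟨?_, ?_⟩ ?_ ?_
    · exact (List.isChain_append.mp (List.cons_append ▸ hpj.1)).1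
    · exact (List.nodup_append'.mp (List.cons_append ▸ hpj.2)).1
    · exact (List.disjoint_append_left.mp hoff).1
    · intro k hk
      exact (List.disjoint_append_left.mp (hjd k hk)).1
  have h2 : IsExtension H P (Function.update (Function.update F j A) i (w :: B)) := by
    have hoff' := (List.disjoint_append_left.mp hoff).2
    refine h1.update ⟨?_, ?_⟩ hoff' ?_
    · rw [List.isChain_cons]
      refine ⟨by simpa using hw, ?_⟩
      exact (List.isChain_append.mp (List.cons_append ▸ hpj.1)).2.1
    · refine List.nodup_cons.mpr ⟨fun h => hoff' h (List.getElem_mem _), ?_⟩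
      exact (List.nodup_append'.mp (List.cons_append ▸ hpj.2)).2.1
    · intro k hk
      by_cases hkj : k = j
      · subst hkj
        rw [Function.update_self]
        exact (List.nodup_append'.mp (List.nodup_cons.mp hpj.2).2).2.2.symm
      · rw [Function.update_of_ne hkj]
        exact (List.disjoint_append_left.mp (hjd k hkj)).2
  have h3 := hmax _ h2
  have h4 := extensionWeight_update F j A
  have h5 := extensionWeight_update (Function.update F j A) i (w :: B)
  rw [Function.update_of_ne hij, hi] at h5
  rw [hAB] at h4
  simp [hA] at h4 h5
  omega

/-- The tips of an extension are pairwise joined by long paths. -/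
theorem IsExtension.exists_isPathList_of_lt (hP : IsPathList H P) (hF : IsExtension H P F)
    {i j : Fin P.length} (hij : i < j) :
    ∃ Q, IsPathList H Q ∧ Q.head? = some (extensionTip F i) ∧
      Q.getLast? = some (extensionTip F j) ∧ (j : ℕ) + 1 ≤ Q.length + i := by
  have hdec := List.eq_take_append_cons_append_cons_drop P (Fin.lt_def.mp hij) j.2
  have hlen : ((P.drop (i + 1)).take (j - i - 1)).length = (j : ℕ) - i - 1 := by
    have := j.2
    simp; omega
  have hti := getLast?_eq_extensionTip (F := F) i
  have htj := getLast?_eq_extensionTip (F := F) j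
  have hFi := hF.path i
  have hFj := hF.path j
  have hoi := hF.off i
  have hoj := hF.off j
  have hd := hF.disjoint i j hij.ne
  have hP1 := hP.1
  have hP2 := hP.2
  generalize (P.drop (i + 1)).take (j - i - 1) = B at hdec hlen
  generalize P.take i = A at hdec
  generalize P.drop (j + 1) = D at hdec
  generalize P[(i : ℕ)] = u at hdec hti hFi
  generalize P[(j : ℕ)] = w at hdec htj hFj
  generalize F i = X at *
  generalize F j = Y at *
  rw [hdec] at hP1 hP2 hoi hoj
  refine ⟨(u :: X).reverse ++ (B ++ w :: Y), ⟨?_, ?_⟩, ?_, ?_, ?_⟩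
  · have hr := IsPathList.reverse hFi
    rw [List.isChain_append, List.isChain_append]
    simp only [List.isChain_append, List.isChain_cons] at hP1
    refine ⟨hr.1, ⟨hP1.2.1.2.1, hFj.1, ?_⟩, ?_⟩
    · simpa using hP1.2.1.2.2.2
    · intro x hx y hy
      rw [List.getLast?_reverse] at hx
      simp at hx
      subst hx
      refine hP1.2.1.1 y ?_
      cases B <;> simpa using hy
  · have h1 := hFi.2
    have h2 := hFj.2
    clear hti htj hFi hFj hP1
    simp only [List.nodup_append', List.nodup_cons, List.mem_append, List.mem_cons,
      List.disjoint_append_right, List.disjoint_cons_left,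
      List.disjoint_cons_right, not_or, List.disjoint_reverse_left, List.mem_reverse,
      List.nodup_reverse] at *
    have := hoj.2.2.1.symm
    tauto
  · rw [List.head?_append, List.head?_reverse, hti]
    rfl
  · rw [List.getLast?_append, List.getLast?_append, htj]
    rfl
  · simp only [List.length_append, List.length_cons, List.length_reverse]
    omega

theorem IsExtension.exists_isPathList (hP : IsPathList H P) (hF : IsExtension H P F)
    (i j : Fin P.length) :
    ∃ Q, IsPathList H Q ∧ Q.head? = some (extensionTip F i) ∧
      Q.getLast? = some (extensionTip F j) ∧
      (j : ℕ) + 1 ≤ Q.length + i ∧ (i : ℕ) + 1 ≤ Q.length + j := by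
  rcases lt_trichotomy i j with h | rfl | h
  · obtain ⟨Q, h1, h2, h3, h4⟩ := hF.exists_isPathList_of_lt hP h
    exact ⟨Q, h1, h2, h3, h4, by have := Fin.lt_def.mp h; omega⟩
  · exact ⟨[extensionTip F i], ⟨by simp, by simp⟩, by simp, by simp, by simp, by simp⟩
  · obtain ⟨Q, h1, h2, h3, h4⟩ := hF.exists_isPathList_of_lt hP h
    exact ⟨Q.reverse, h1.reverse, by simpa using h3, by simpa using h2,
      by have := Fin.lt_def.mp h; simp; omega, by simpa using h4⟩

/-- The trivial path at `i` is adjacent to the first vertex of the path at `j`. -/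
def TrivialAdjHead (H : SimpleGraph W) (F : Fin P.length → List W) (i j : Fin P.length) : Prop :=
  F i = [] ∧ ∃ y, (F j).head? = some y ∧ H.Adj P[(i : ℕ)] y

open scoped Classical in
theorem IsExtension.card_adj_le_of_eq_nil [Fintype W] (hP : IsPathList H P)
    (hF : IsExtension H P F)
    (hmax : ∀ F', IsExtension H P F' → extensionWeight F' ≤ extensionWeight F)
    {i : Fin P.length} (hi : F i = []) :
    (Finset.univ.filter (H.Adj (extensionTip F i))).card ≤
      P.length - 1 + (Finset.univ.filter (TrivialAdjHead H F i)).card := by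
  have hsub : Finset.univ.filter (H.Adj (extensionTip F i)) ⊆ P.toFinset.erase P[(i : ℕ)] ∪
      (Finset.univ.filter (TrivialAdjHead H F i)).image fun j => (F j).head?.getD P[(j : ℕ)] := by
    intro w hw
    have hw' : H.Adj (extensionTip F i) w := by simpa using hw
    rcases hF.mem_of_adj_tip hmax hw' with h | ⟨j, hj⟩
    · refine Finset.mem_union_left _ (Finset.mem_erase.mpr ⟨?_, by simpa using h⟩)
      rw [extensionTip_of_eq_nil hi] at hw'
      exact hw'.ne'
    · rw [extensionTip_of_eq_nil hi] at hw'
      have hh := hF.head?_eq_of_adj hmax hi hj hw'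
      refine Finset.mem_union_right _ (Finset.mem_image.mpr ⟨j, ?_, by simp [hh]⟩)
      simpa using ⟨hi, w, hh, hw'⟩
  refine (Finset.card_le_card hsub).trans ((Finset.card_union_le _ _).trans ?_)
  refine Nat.add_le_add ?_ Finset.card_image_le
  rw [Finset.card_erase_of_mem (by simp), List.toFinset_card_of_nodup hP.2]

open scoped Classical in
theorem IsExtension.two_mul_card_trivialAdjHead_le (hP : IsPathList H P)
    (hPmax : ∀ l, IsPathList H l → l.length ≤ P.length) (hF : IsExtension H P F)
    (j : Fin P.length) :
    2 * (Finset.univ.filter fun i => TrivialAdjHead H F i j).card + 2 * (F j).length ≤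
      P.length + 1 := by
  have hpj := hF.path j
  have hoff := hF.off j
  have hbranch : ∀ i : Fin P.length, TrivialAdjHead H F i j →
      (F j).length ≤ i ∧ i + (F j).length + 1 ≤ P.length := by
    rintro i ⟨-, y, hy, hadj⟩
    refine hP.length_le_of_branch hPmax i.2 (List.nodup_cons.mp hpj.2).2 hoff ?_
    rw [List.isChain_cons]
    refine ⟨?_, (List.isChain_cons.mp hpj.1).2⟩
    rw [hy]
    simpa using hadj
  have hlen : 2 * (F j).length ≤ P.length + 1 := by
    have := hP.length_le_of_branch hPmax j.2 (List.nodup_cons.mp hpj.2).2 hoff hpj.1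
    omega
  have := Finset.two_mul_card_le_of_separated
    (Finset.univ.filter fun i => TrivialAdjHead H F i j)
    (fun i => (i : ℕ) - (F j).length + 1) (fun _ => 0) (P.length + 1 - 2 * (F j).length) ?_ ?_ ?_
  · omega
  · intro i hi
    have := hbranch i (by simpa using hi)
    omega
  · intro i hi i' hi' he _
    have := hbranch i (by simpa using hi)
    have := hbranch i' (by simpa using hi')
    exact Fin.ext (by omega)
  · intro i hi i' hi' he
    have h1 := hbranch i (by simpa using hi)
    have h2 := hbranch i' (by simpa using hi')
    obtain ⟨-, y, hy, hadj⟩ : TrivialAdjHead H F i j := by simpa using hi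
    obtain ⟨-, y', hy', hadj'⟩ : TrivialAdjHead H F i' j := by simpa using hi'
    obtain rfl : y = y' := by simpa [hy] using hy'
    have hyP : y ∉ P := hoff (List.mem_of_mem_head? hy)
    have := hP.length_add_one_le_of_detour hPmax (k := i) (k' := i') (M := [y]) (by omega) i'.2
      (by simp) (by simpa using hyP) (by simpa using ⟨hadj, hadj'.symm⟩)
    simp at this
    omega

open scoped Classical in
theorem IsExtension.two_mul_card_adj_notMem_le [Fintype W] (hP : IsPathList H P)
    (hPmax : ∀ l, IsPathList H l → l.length ≤ P.length) (hF : IsExtension H P F)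
    (hmax : ∀ F', IsExtension H P F' → extensionWeight F' ≤ extensionWeight F)
    {j : Fin P.length} (hj : F j ≠ []) :
    2 * (Finset.univ.filter fun w => H.Adj (extensionTip F j) w ∧ w ∉ F j).card ≤
      P.length - 1 := by
  set z := extensionTip F j with hz
  have hzj : z ∈ F j := extensionTip_mem_of_ne_nil hj
  have hzP : z ∉ P := hF.off j hzj
  have hpos : ∀ w, H.Adj z w ∧ w ∉ F j → ∃ (k : Fin P.length) (M : List W), M <+: F k ∧
      (P[(k : ℕ)] :: M).getLast? = some w ∧ z ∉ M := by
    rintro w ⟨hadj, hwj⟩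
    rcases hF.mem_of_adj_tip hmax hadj with h | ⟨k, hk⟩
    · obtain ⟨k, hk, rfl⟩ := List.getElem_of_mem h
      exact ⟨⟨k, hk⟩, [], List.nil_prefix, by simp, by simp⟩
    · obtain ⟨A, B, hAB⟩ := List.append_of_mem hk
      have hkj : k ≠ j := by rintro rfl; exact hwj hk
      have hpre : (A ++ [w]) <+: F k := ⟨B, by simp [hAB]⟩
      refine ⟨k, A ++ [w], hpre, ?_, fun h => hF.disjoint k j hkj (hpre.subset h) hzj⟩
      rw [← List.cons_append, List.getLast?_concat]
  have : Nonempty (Fin P.length) := ⟨j⟩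
  choose! k M hpre hlast hzM using hpos
  have hpath : ∀ w, H.Adj z w ∧ w ∉ F j → IsPathList H (P[(k w : ℕ)] :: M w) := fun w hw =>
    have hp : (P[(k w : ℕ)] :: M w) <+: (P[(k w : ℕ)] :: F (k w)) :=
      List.cons_prefix_cons.mpr ⟨rfl, hpre w hw⟩
    ⟨(hF.path (k w)).1.prefix hp, (hF.path (k w)).2.sublist hp.sublist⟩
  have hMP : ∀ w, H.Adj z w ∧ w ∉ F j → (M w).Disjoint P := fun w hw x hx =>
    hF.off (k w) ((hpre w hw).subset hx)
  refine Finset.two_mul_card_le_of_separated _ (fun w => (k w : ℕ)) (fun w => (M w).length) _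
    ?_ ?_ ?_
  · intro w hw
    replace hw : H.Adj z w ∧ w ∉ F j := by simpa using hw
    have := hP.length_le_of_branch hPmax (k w).2 (M := M w ++ [z]) ?_ ?_ ?_
    · simp only [List.length_append, List.length_singleton] at this
      omega
    · rw [List.nodup_append']
      exact ⟨(List.nodup_cons.mp (hpath w hw).2).2, by simp, by simpa using hzM w hw⟩
    · rw [List.disjoint_append_left]
      exact ⟨hMP w hw, by simpa using hzP⟩
    · rw [← List.cons_append, List.isChain_append]
      refine ⟨(hpath w hw).1, by simp, ?_⟩
      rw [hlast w hw]
      simpa using hw.1.symm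
  · intro w hw w' hw' hk hM
    replace hw : H.Adj z w ∧ w ∉ F j := by simpa using hw
    replace hw' : H.Adj z w' ∧ w' ∉ F j := by simpa using hw'
    have hk' : k w = k w' := Fin.ext hk
    have hM' : M w = M w' := by
      have h1 := hpre w hw
      rw [hk'] at h1
      exact (List.prefix_of_prefix_length_le h1 (hpre w' hw') hM.le).eq_of_length hM
    have h1 := hlast w hw
    have h2 := hlast w' hw'
    simp only [hk', hM'] at h1
    exact Option.some.inj (h1.symm.trans h2)
  · intro w hw w' hw' hk
    replace hw : H.Adj z w ∧ w ∉ F j := by simpa using hw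
    replace hw' : H.Adj z w' ∧ w' ∉ F j := by simpa using hw'
    have hkk : k w ≠ k w' := fun h => by simp [h] at hk
    have hr := (hpath w' hw').reverse
    have := hP.length_add_one_le_of_detour hPmax (M := M w ++ (z :: (M w').reverse)) hk (k w').2
      ?_ ?_ ?_
    · simp only [List.length_append, List.length_cons, List.length_reverse] at this
      omega
    · rw [List.nodup_append', List.nodup_cons]
      refine ⟨(List.nodup_cons.mp (hpath w hw).2).2, ⟨by simpa using hzM w' hw',
        List.nodup_reverse.mpr (List.nodup_cons.mp (hpath w' hw').2).2⟩, ?_⟩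
      rw [List.disjoint_cons_right, List.disjoint_reverse_right]
      exact ⟨hzM w hw, fun x hx hx' => hF.disjoint _ _ hkk ((hpre w hw).subset hx)
        ((hpre w' hw').subset hx')⟩
    · rw [List.disjoint_append_left, List.disjoint_cons_left, List.disjoint_reverse_left]
      exact ⟨hMP w hw, hzP, hMP w' hw'⟩
    · have e : P[(k w : ℕ)] :: (M w ++ z :: (M w').reverse ++ [P[(k w' : ℕ)]]) =
          (P[(k w : ℕ)] :: M w) ++ z :: (P[(k w' : ℕ)] :: M w').reverse := by simp
      rw [e, List.isChain_append]
      refine ⟨(hpath w hw).1, List.isChain_cons.mpr ⟨?_, hr.1⟩, ?_⟩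
      · rw [List.head?_reverse, hlast w' hw']
        simpa using hw'.1
      · rw [hlast w hw]
        simpa using hw.1.symm

open scoped Classical in
theorem IsExtension.card_adj_add_le_of_ne_nil [Fintype W] (hP : IsPathList H P)
    (hPmax : ∀ l, IsPathList H l → l.length ≤ P.length) (hF : IsExtension H P F)
    (hmax : ∀ F', IsExtension H P F' → extensionWeight F' ≤ extensionWeight F)
    {j : Fin P.length} (hj : F j ≠ []) :
    (Finset.univ.filter (H.Adj (extensionTip F j))).card +
      (Finset.univ.filter fun i => TrivialAdjHead H F i j).card ≤ P.length - 1 := by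
  have h1 := hF.two_mul_card_trivialAdjHead_le hP hPmax j
  have h2 := hF.two_mul_card_adj_notMem_le hP hPmax hmax hj
  have hzj : extensionTip F j ∈ F j := extensionTip_mem_of_ne_nil hj
  have hsub : Finset.univ.filter (H.Adj (extensionTip F j)) ⊆
      (F j).toFinset.erase (extensionTip F j) ∪
        Finset.univ.filter fun w => H.Adj (extensionTip F j) w ∧ w ∉ F j := by
    intro w hw
    have hw' : H.Adj (extensionTip F j) w := by simpa using hw
    by_cases h : w ∈ F j
    · exact Finset.mem_union_left _ (Finset.mem_erase.mpr ⟨hw'.ne', by simpa using h⟩)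
    · exact Finset.mem_union_right _ (by simpa using ⟨hw', h⟩)
  have h3 := (Finset.card_le_card hsub).trans (Finset.card_union_le _ _)
  rw [Finset.card_erase_of_mem (by simpa using hzj),
    List.toFinset_card_of_nodup (List.nodup_cons.mp (hF.path j).2).2] at h3
  have h4 := List.length_pos_of_mem hzj
  have h5 := j.2
  omega

open scoped Classical in
theorem IsExtension.sum_card_adj_le [Fintype W] (hP : IsPathList H P)
    (hPmax : ∀ l, IsPathList H l → l.length ≤ P.length) (hF : IsExtension H P F)
    (hmax : ∀ F', IsExtension H P F' → extensionWeight F' ≤ extensionWeight F) :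
    ∑ i, (Finset.univ.filter (H.Adj (extensionTip F i))).card ≤ P.length * (P.length - 1) := by
  have key : ∀ i, (Finset.univ.filter (H.Adj (extensionTip F i))).card +
      (Finset.univ.filter fun i' => TrivialAdjHead H F i' i).card ≤
      P.length - 1 + (Finset.univ.filter (TrivialAdjHead H F i)).card := by
    intro i
    by_cases hi : F i = []
    · have h1 := hF.card_adj_le_of_eq_nil hP hmax hi
      have h2 : (Finset.univ.filter fun i' => TrivialAdjHead H F i' i) = ∅ := by
        simp [TrivialAdjHead, hi]
      rw [h2]
      simpa using h1
    · exact (hF.card_adj_add_le_of_ne_nil hP hPmax hmax hi).trans (Nat.le_add_right _ _)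
  have hsum := Finset.sum_le_sum fun i (_ : i ∈ Finset.univ) => key i
  have hswap := Finset.sum_card_bipartiteAbove_eq_sum_card_bipartiteBelow
    (s := (Finset.univ : Finset (Fin P.length))) (t := (Finset.univ : Finset (Fin P.length)))
    (TrivialAdjHead H F)
  simp only [Finset.bipartiteAbove, Finset.bipartiteBelow] at hswap
  rw [Finset.sum_add_distrib, Finset.sum_add_distrib, hswap] at hsum
  simpa using hsum

end Extension

open scoped Classical in
/-- Consecutively numbered vertices off a longest cycle that are joined by long paths off the cycle
have few neighbours on the cycle. -/
theorem IsCycleList.card_mul_sum_card_adj_le {V : Type*} {G : SimpleGraph V} {L : List V}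
    (hL : IsCycleList G L) (hmax : ∀ l, IsCycleList G l → l.length ≤ L.length) {p : ℕ}
    (z : Fin (p + 1) → V)
    (hz : ∀ i j, ∃ Q, IsPathList G Q ∧ L.Disjoint Q ∧ Q.head? = some (z i) ∧
      Q.getLast? = some (z j) ∧ (j : ℕ) + 1 ≤ Q.length + i ∧ (i : ℕ) + 1 ≤ Q.length + j) :
    (p + 2) * ∑ i, (Finset.univ.filter fun a : Fin L.length => G.Adj L[(a : ℕ)] (z i)).card ≤
      L.length * (p + 1) := by
  have hgap : ∀ (a a' : Fin L.length) (i i' : Fin (p + 1)), a < a' → G.Adj L[(a : ℕ)] (z i) →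
      G.Adj L[(a' : ℕ)] (z i') → ∃ q : ℕ, (i' : ℕ) + 1 ≤ q + i ∧ (i : ℕ) + 1 ≤ q + i' ∧
        a + q + 1 ≤ a' ∧ a' + q + 1 ≤ L.length + a := by
    intro a a' i i' ha hi hi'
    obtain ⟨Q, hQ, hd, hh, hl, h1, h2⟩ := hz i i'
    have hne : Q ≠ [] := by rintro rfl; simp at hh
    exact ⟨Q.length, h1, h2, hL.gap hmax hQ hne hd ha a'.2 (by simpa [hh] using hi)
      (by simpa [hl] using hi'.symm)⟩
  have hcyc := card_mul_le_of_cyclic_gap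
    (fun a : Fin L.length => Finset.univ.filter fun i => G.Adj L[(a : ℕ)] (z i)) ?_ ?_ ?_
  · have hswap := Finset.sum_card_bipartiteAbove_eq_sum_card_bipartiteBelow
      (s := (Finset.univ : Finset (Fin L.length))) (t := (Finset.univ : Finset (Fin (p + 1))))
      (fun (a : Fin L.length) i => G.Adj L[(a : ℕ)] (z i))
    simp only [Finset.bipartiteAbove, Finset.bipartiteBelow] at hswap
    rwa [hswap] at hcyc
  · intro a a' i i' ha hi hi' _
    obtain ⟨q, h1, h2, h3, h4⟩ := hgap a a' i i' ha (by simpa using hi) (by simpa using hi')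
    omega
  · intro a a' i i' ha hi hi' _
    obtain ⟨q, h1, h2, h3, h4⟩ := hgap a a' i i' ha (by simpa using hi) (by simpa using hi')
    omega
  · intro a i hi i' hi'
    have h3 := hL.2.1
    obtain ⟨Q, hQ, hd, hh, hl, h1, h2⟩ := hz i i'
    by_cases h : 2 ≤ Q.length
    · have := IsCycleList.length_add_one_le hmax hQ (hd (List.getElem_mem a.2)) h
        (by simpa [hh] using hi) (by simpa [hl, G.adj_comm] using hi')
      omega
    · omega

/-- A longest cycle is long in terms of the minimum degree and a longest path off the cycle. -/
theorem IsCycleList.mul_minDegree_le {V : Type*} [Fintype V] {G : SimpleGraph V}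
    [DecidableRel G.Adj] {L : List V} {s : Set V} (hL : IsCycleList G L)
    (hmax : ∀ l, IsCycleList G l → l.length ≤ L.length) (hs : ∀ x, x ∈ s ↔ x ∉ L) {p : ℕ}
    {P : List s} (hP : IsPathList (G.induce s) P) (hlen : P.length = p + 1)
    (hPmax : ∀ l, IsPathList (G.induce s) l → l.length ≤ p + 1) :
    (p + 2) * G.minDegree ≤ L.length + (p + 2) * p := by
  classical
  have hPmax' : ∀ l, IsPathList (G.induce s) l → l.length ≤ P.length := by rwa [hlen]
  obtain ⟨F, hF, hFmax⟩ := exists_isExtension_maximal (G.induce s) P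
  have hsum : ∑ i, (Finset.univ.filter ((G.induce s).Adj (extensionTip F i))).card ≤
      P.length * (P.length - 1) := by
    convert hF.sum_card_adj_le hP hPmax' hFmax
  have hpaths := hF.exists_isPathList hP
  generalize extensionTip F = z at hsum hpaths
  clear hFmax hF F hPmax' hPmax
  generalize P.length = m at *
  subst hlen
  have hcyc : (p + 2) * ∑ i,
      (Finset.univ.filter fun a : Fin L.length => G.Adj L[(a : ℕ)] (z i)).card ≤
      L.length * (p + 1) := by
    convert hL.card_mul_sum_card_adj_le hmax (fun i => (z i : V)) ?_
    intro i j
    obtain ⟨Q, hQ, hh, hl, h1, h2⟩ := hpaths i j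
    refine ⟨Q.map Subtype.val, ⟨?_, hQ.2.map Subtype.val_injective⟩, ?_,
      by rw [List.head?_map, hh, Option.map_some], by rw [List.getLast?_map, hl, Option.map_some],
      by simpa using h1, by simpa using h2⟩
    · rw [List.isChain_map]
      exact hQ.1
    · intro x hx hx'
      obtain ⟨y, -, rfl⟩ := List.mem_map.mp hx'
      exact (hs y).mp y.2 hx
  have hdeg : ∀ i, G.minDegree ≤
      (Finset.univ.filter fun a : Fin L.length => G.Adj L[(a : ℕ)] (z i)).card +
        (Finset.univ.filter ((G.induce s).Adj (z i))).card := by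
    intro i
    refine (G.minDegree_le_degree (z i)).trans ?_
    have hsub : G.neighborFinset (z i) ⊆
        (Finset.univ.filter fun a : Fin L.length => G.Adj L[(a : ℕ)] (z i)).image
          (fun a : Fin L.length => L[(a : ℕ)]) ∪
        (Finset.univ.filter ((G.induce s).Adj (z i))).image Subtype.val := by
      intro w hw
      replace hw : G.Adj (z i) w := by simpa using hw
      by_cases h : w ∈ L
      · obtain ⟨a, ha, rfl⟩ := List.getElem_of_mem h
        exact Finset.mem_union_left _ (Finset.mem_image.mpr
          ⟨⟨a, ha⟩, by simpa using hw.symm, rfl⟩)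
      · exact Finset.mem_union_right _ (Finset.mem_image.mpr
          ⟨⟨w, (hs w).mpr h⟩, by simpa using hw, rfl⟩)
    rw [← G.card_neighborFinset_eq_degree]
    exact (Finset.card_le_card hsub).trans ((Finset.card_union_le _ _).trans
      (Nat.add_le_add Finset.card_image_le Finset.card_image_le))
  have hdeg' := Finset.sum_le_sum fun i (_ : i ∈ Finset.univ) => hdeg i
  rw [Finset.sum_add_distrib] at hdeg'
  simp only [Finset.sum_const, Finset.card_univ, Fintype.card_fin, smul_eq_mul,
    Nat.add_sub_cancel] at hdeg' hsum
  refine Nat.le_of_mul_le_mul_left ?_ (Nat.succ_pos p)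
  have := Nat.mul_le_mul_left (p + 2) (hdeg'.trans (Nat.add_le_add_left hsum _))
  simp only [Nat.succ_eq_add_one]
  linarith

theorem exists_isPathList_length_eq_pbar {W : Type*} [Fintype W] [Nonempty W] (H : SimpleGraph W) :
    ∃ (p : ℕ) (P : List W), pbar H = p ∧ IsPathList H P ∧ P.length = p + 1 ∧
      ∀ l, IsPathList H l → l.length ≤ p + 1 := by
  let S : Set ℕ := {n | ∃ (u v : W) (p : H.Walk u v), p.IsPath ∧ p.length = n}
  obtain ⟨w⟩ := ‹Nonempty W›
  have hne : S.Nonempty := ⟨0, w, w, Walk.nil, by simp, by simp⟩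
  have hbdd : BddAbove S := by
    refine ⟨Fintype.card W, ?_⟩
    rintro n ⟨u, v, p, hp, rfl⟩
    exact hp.length_lt.le
  obtain ⟨u, v, q, hq, hlen⟩ := Nat.sSup_mem hne hbdd
  refine ⟨sSup S, q.support, if_pos ⟨w⟩, ⟨q.isChain_adj_support, hq.support_nodup⟩, by simp [hlen],
    fun l hl => ?_⟩
  rcases eq_or_ne l [] with rfl | hl'
  · simp
  · obtain ⟨u', v', q', hq', hlen'⟩ := hl.exists_walk hl'
    rw [← hlen']
    exact Nat.add_le_add_right (le_csSup hbdd ⟨u', v', q', hq', rfl⟩) 1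

/-- The minimum degree is controlled by the number of vertices and `pbar` off a longest cycle. -/
theorem IsLongestCycle.mul_minDegree_sub_pbar_le {V : Type*} [Fintype V] {G : SimpleGraph V}
    [DecidableRel G.Adj] {v : V} {C : G.Walk v v} (hC : IsLongestCycle G C) :
    -1 ≤ pbar (G.induce {x : V | x ∉ C.support}) ∧
    (pbar (G.induce {x : V | x ∉ C.support}) + 2) *
      (G.minDegree - pbar (G.induce {x : V | x ∉ C.support})) +
      pbar (G.induce {x : V | x ∉ C.support}) + 1 ≤ Fintype.card V := by
  classical
  by_cases hne : Nonempty {x : V | x ∉ C.support}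
  · obtain ⟨p, P, hp, hP, hlen, hPmax⟩ :=
      exists_isPathList_length_eq_pbar (G.induce {x : V | x ∉ C.support})
    obtain ⟨hL, -⟩ := hC.1.isCycleList
    have hlenC := hC.1.isCycleList.2
    have hmem : ∀ x, x ∈ {x : V | x ∉ C.support} ↔ x ∉ C.support.tail := fun x => by
      rw [Set.mem_ofPred_eq, not_iff_not]
      refine ⟨fun h => ?_, List.mem_of_mem_tail⟩
      rcases (Walk.mem_support_iff C).mp h with rfl | h
      · exact C.end_mem_tail_support hC.1.not_nil
      · exact h
    have hmax : ∀ l, IsCycleList G l → l.length ≤ C.support.tail.length := fun l hl => by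
      obtain ⟨u, D, hD, hDlen⟩ := hl.exists_cycle
      rw [← hDlen, hlenC]
      exact hC.2 u D hD
    have hbound := hL.mul_minDegree_le hmax hmem hP hlen hPmax
    have hcard : C.support.tail.length + (p + 1) ≤ Fintype.card V := by
      have : (C.support.tail ++ P.map Subtype.val).Nodup := by
        rw [List.nodup_append']
        refine ⟨hL.1.2, hP.2.map Subtype.val_injective, fun x hx hx' => ?_⟩
        obtain ⟨y, -, rfl⟩ := List.mem_map.mp hx'
        exact (hmem y).mp y.2 hx
      simpa [hlen] using this.length_le_card
    rw [hp]
    zify at hbound hcard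
    refine ⟨by omega, ?_⟩
    linarith
  · have : pbar (G.induce {x : V | x ∉ C.support}) = -1 := if_neg hne
    rw [this]
    have : Nonempty V := ⟨v⟩
    have := G.minDegree_lt_card
    refine ⟨le_rfl, ?_⟩
    push_cast
    omega

/-- Theorem 2: if `δ ≥ (n+2)/(l+1) + l - 2` then a longest cycle `C` satisfies either
`p̄ ≤ min (l-2) (δ-l-1)` or `p̄ ≥ max l (δ-l+1)`. -/
theorem stmt_1 {V : Type*} [Fintype V] [DecidableEq V] (G : SimpleGraph V)
    [DecidableRel G.Adj] (l : ℕ) (hl : 1 ≤ l)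
    {v : V} (C : G.Walk v v) (hC : IsLongestCycle G C)
    (hdeg : (G.minDegree : ℝ) ≥ ((Fintype.card V : ℝ) + 2) / ((l : ℝ) + 1) + (l : ℝ) - 2) :
    pbar (G.induce {x : V | x ∉ C.support}) ≤
        min ((l : ℤ) - 2) ((G.minDegree : ℤ) - (l : ℤ) - 1) ∨
      pbar (G.induce {x : V | x ∉ C.support}) ≥
        max (l : ℤ) ((G.minDegree : ℤ) - (l : ℤ) + 1) := by
  obtain ⟨hp, hbound⟩ := hC.mul_minDegree_sub_pbar_le
  generalize pbar (G.induce {x : V | x ∉ C.support}) = p at hp hbound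
  have hn : (Fintype.card V + 2 : ℤ) ≤ (G.minDegree - l + 2) * (l + 1) := by
    have h : ((Fintype.card V : ℝ) + 2) / ((l : ℝ) + 1) ≤ G.minDegree - l + 2 := by linarith
    rw [div_le_iff₀ (by positivity)] at h
    exact_mod_cast h
  generalize (G.minDegree : ℤ) = d at *
  generalize (Fintype.card V : ℤ) = n at *
  have hprod : 0 < ((l : ℤ) - 1 - p) * (d - l - p) := by linarith
  rcases pos_and_pos_or_neg_and_neg_of_mul_pos hprod with h | h
  · exact Or.inl (le_min (by omega) (by omega))
  · exact Or.inr (max_le (by omega) (by omega))
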